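/- For every n ≥ 1 and every vertically labelled lattice path (π,u) ∈ Vert(C_n), dinv'_C(π,u) = area'(ζ_C(π), d_C(π,u)). -/

import Mathlib

inductive Step
  | N : Step
  | E : Step
  deriving DecidableEq

/-- The number of East steps strictly preceding the `k`-th North step. -/
def ebn : List Step → ℕ → ℕ
  | _, 0 => 0
  | [], _ + 1 => 0
  | Step.E :: rest, k + 1 => ebn rest (k + 1) + 1
  | Step.N :: rest, k + 1 => ebn rest k

/-- A lattice path with `a` East steps and `b` North steps. -/
def IsLatticePath (a b : ℕ) (π : List Step) : Prop :=
  π.count Step.E = a ∧ π.count Step.N = b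

/-- A ballot path of length `m`: every prefix has at least as many `N`s as `E`s. -/
def IsBallotPath (m : ℕ) (β : List Step) : Prop :=
  β.length = m ∧ ∀ k : ℕ, (β.take k).count Step.E ≤ (β.take k).count Step.N

/-- `i` is a rise: the `i`-th North step is immediately followed by a North step. -/
def IsRise (π : List Step) (i : ℕ) : Prop :=
  ∃ p : ℕ, π[p]? = some Step.N ∧ π[p + 1]? = some Step.N ∧ (π.take p).count Step.N + 1 = i

/-- `(i,j)` is a valley: the `i`-th East step is immediately followed by the `j`-th North
step; in addition if the path ends with an East step and consists of `i` East steps and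
`j - 1` North steps, then `(i, j)` counts as a valley. -/
def IsValley (β : List Step) (i j : ℕ) : Prop :=
  (∃ p : ℕ, β[p]? = some Step.E ∧ β[p + 1]? = some Step.N ∧
      (β.take p).count Step.E + 1 = i ∧ (β.take (p + 1)).count Step.N + 1 = j) ∨
  (β.getLast? = some Step.E ∧ i = β.count Step.E ∧ j = β.count Step.N + 1)

/-- Read `a` from left to right, writing `N` for each entry `j` and `E` for each entry `j+1`. -/
def sPlusL (j : ℤ) (a : List ℤ) : List Step :=
  a.filterMap fun x => if x = j then some Step.N else if x = j + 1 then some Step.E else none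

/-- Read `a` from right to left, writing `N` for each entry `j` and `E` for each entry `j+1`. -/
def sPlusR (j : ℤ) (a : List ℤ) : List Step := sPlusL j a.reverse

/-- Read `a` from left to right, writing `N` for each entry `-j` and `E` for each entry `-j-1`. -/
def sMinusL (j : ℤ) (a : List ℤ) : List Step :=
  a.filterMap fun x => if x = -j then some Step.N else if x = -j - 1 then some Step.E else none

/-- Read `a` from right to left, writing `N` for each entry `-j` and `E` for each entry `-j-1`. -/
def sMinusR (j : ℤ) (a : List ℤ) : List Step := sMinusL j a.reverse

/-- The type `Cₙ` area vector of a lattice path, `μ k = (n+1-k) - λ_{n+1-k}` (1-based). -/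
def areaC (n : ℕ) (π : List Step) (k : ℕ) : ℤ :=
  ((n : ℤ) + 1 - k) - ebn π (n + 1 - k)

def areaCList (n : ℕ) (π : List Step) : List ℤ :=
  (List.range n).map fun k => areaC n π (k + 1)

/-- The type `Cₙ` zeta map. -/
def zetaC (n : ℕ) (π : List Step) : List Step :=
  ((List.range (n + 1)).reverse.map (fun j =>
    sMinusR (j : ℤ) (areaCList n π) ++ sPlusL (j : ℤ) (areaCList n π))).flatten

/-- `w` is the window `[w(1),…,w(n)]` of a signed permutation of rank `n`. -/
def IsSignedPerm (n : ℕ) (w : Fin n → ℤ) : Prop :=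
  (∀ i, 1 ≤ |w i| ∧ |w i| ≤ (n : ℤ)) ∧ Function.Injective fun i => |w i|

/-- Evaluation of (the window of) a signed permutation at any integer, via `w(-j) = -w(j)`
and `w(0) = 0`. -/
def evalSP {n : ℕ} (w : Fin n → ℤ) (j : ℤ) : ℤ :=
  if h : 1 ≤ j ∧ j ≤ (n : ℤ) then w ⟨(j - 1).toNat, by omega⟩
  else if h' : 1 ≤ -j ∧ -j ≤ (n : ℤ) then -w ⟨(-j - 1).toNat, by omega⟩
  else 0

/-- Vertically labelled lattice paths of type `Cₙ` (also of type `Bₙ`). -/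
def VertC (n : ℕ) : Set (List Step × (Fin n → ℤ)) :=
  {p : List Step × (Fin n → ℤ) | IsLatticePath n n p.1 ∧ IsSignedPerm n p.2 ∧
    (∀ i : ℕ, IsRise p.1 i → evalSP p.2 (i : ℤ) < evalSP p.2 ((i : ℤ) + 1)) ∧
    (p.1.head? = some Step.N → 0 < evalSP p.2 1)}

/-- The diagonal reading word of type `Cₙ` as the list of its window entries. -/
def dCList (n : ℕ) (π : List Step) (w : Fin n → ℤ) : List ℤ :=
  ((List.range (n + 1)).map (fun i =>
    ((List.finRange n).reverse.filterMap (fun j =>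
      if areaC n π (n - j.val) = -(i : ℤ) then some (-(w j)) else none)) ++
    ((List.finRange n).filterMap (fun j =>
      if areaC n π (n - j.val) = (i : ℤ) + 1 then some (w j) else none)))).flatten

/-- The diagonal reading word of type `Cₙ`. -/
def dC (n : ℕ) (π : List Step) (w : Fin n → ℤ) : Fin n → ℤ :=
  fun i => (dCList n π w).getD i.val 0

/-- `eI n k` is the standard basis vector `e_k` (1-based); zero if `k` is out of range. -/
def eI (n : ℕ) (k : ℕ) : Fin n → ℤ := fun t => if t.val + 1 = k then 1 else 0

/-- The positive roots of type `Cₙ`. -/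
def PosRootsC (n : ℕ) : Set (Fin n → ℤ) :=
  {x | (∃ i j : ℕ, 1 ≤ i ∧ i < j ∧ j ≤ n ∧ (x = eI n j - eI n i ∨ x = eI n j + eI n i)) ∨
       (∃ i : ℕ, 1 ≤ i ∧ i ≤ n ∧ x = (2 : ℤ) • eI n i)}

/-- The root poset order: `α ≤ β` iff `β - α` is a sum of positive roots. -/
def rootLE (n : ℕ) (α β : Fin n → ℤ) : Prop :=
  β - α ∈ AddSubmonoid.closure (PosRootsC n)

/-- The positive root associated to a valley `(i,j)` of a ballot path in `B_{2n}`. -/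
def rootOfValleyC (n : ℕ) (i j : ℕ) : Fin n → ℤ :=
  if j ≤ n then eI n (n + 1 - i) - eI n (n + 1 - j)
  else eI n (n + 1 - i) + eI n (j - n)

/-- The antichain `A_β` of a ballot path `β`. -/
def antichainC (n : ℕ) (β : List Step) : Set (Fin n → ℤ) :=
  {α | ∃ i j : ℕ, IsValley β i j ∧ α = rootOfValleyC n i j}

/-- The order ideal `I_β` of positive roots not above any element of `A_β`. -/
def idealC (n : ℕ) (β : List Step) : Set (Fin n → ℤ) :=
  {x | x ∈ PosRootsC n ∧ ¬ ∃ y ∈ antichainC n β, rootLE n y x}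

/-- `area β = |I_β|`. -/
noncomputable def areaStatC (n : ℕ) (β : List Step) : ℕ := (idealC n β).ncard

/-- The action of a signed permutation on `ℤⁿ`, determined by `u · e_i = sgn(u(i)) e_{|u(i)|}`. -/
def actSP (n : ℕ) (w : Fin n → ℤ) (x : Fin n → ℤ) : Fin n → ℤ :=
  fun k => ∑ i : Fin n, if |w i| = (k.val : ℤ) + 1 then (w i).sign * x i else 0

/-- `area'(β, w)`: the number of roots in `I_β` sent to positive roots by `w`. -/
noncomputable def areaPrimeC (n : ℕ) (β : List Step) (w : Fin n → ℤ) : ℕ :=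
  {x : Fin n → ℤ | x ∈ idealC n β ∧ actSP n w x ∈ PosRootsC n}.ncard

/-- The type `Cₙ` labelled diagonal inversion statistic. -/
def dinvPrimeC (n : ℕ) (π : List Step) (u : Fin n → ℤ) : ℕ :=
  (Finset.univ.filter (fun p : Fin n × Fin n =>
    p.1 < p.2 ∧ areaC n π (n - p.1.val) = areaC n π (n - p.2.val) ∧ u p.1 < u p.2)).card +
  (Finset.univ.filter (fun p : Fin n × Fin n =>
    p.1 < p.2 ∧ areaC n π (n - p.1.val) = areaC n π (n - p.2.val) + 1 ∧ u p.2 < u p.1)).card +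
  (Finset.univ.filter (fun p : Fin n × Fin n =>
    p.1 < p.2 ∧ areaC n π (n - p.1.val) = -areaC n π (n - p.2.val) ∧ u p.1 < -u p.2)).card +
  (Finset.univ.filter (fun p : Fin n × Fin n =>
    p.1 < p.2 ∧ areaC n π (n - p.1.val) = -areaC n π (n - p.2.val) + 1 ∧ -u p.2 < u p.1)).card +
  (Finset.univ.filter (fun i : Fin n => areaC n π (n - i.val) = 0 ∧ u i < 0)).card

/-! ### Valleys and prefixes -/

/-- Some valley lies weakly to the right of column `i` and weakly below row `j` iff the path
reaches `i` East steps before it reaches `j` North steps. -/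
theorem exists_isValley_iff (β : List Step) {i j : ℕ} (hi : 1 ≤ i) :
    (∃ i' j', IsValley β i' j' ∧ i ≤ i' ∧ j' ≤ j) ↔
      ∃ k, i ≤ (β.take k).count Step.E ∧ (β.take k).count Step.N < j := by
  have hsucc : ∀ k x, β[k]? = some x → β.take (k + 1) = β.take k ++ [x] := by
    intro k x h
    rw [List.take_add_one, h]; rfl
  constructor
  · rintro ⟨i', j', ⟨p, hE, hN, rfl, rfl⟩ | ⟨hl, rfl, rfl⟩, h1, h2⟩
    · refine ⟨p + 1, ?_, by omega⟩
      rw [hsucc p _ hE]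
      simpa using h1
    · exact ⟨β.length, by simpa using h1, by simpa using h2⟩
  · intro hex
    have hfirst := Nat.find_spec hex
    classical
    have hk0 : Nat.find hex ≠ 0 := by
      intro h
      rw [h] at hfirst
      simp at hfirst
      omega
    obtain ⟨k, hk⟩ := Nat.exists_eq_succ_of_ne_zero hk0
    have hmin := Nat.find_min hex (m := k) (by omega)
    rw [hk] at hfirst
    have hkE : β[k]? = some Step.E := by
      rcases hβ : β[k]? with _ | ⟨_ | _⟩
      · exfalso
        apply hmin
        have hlen : β.length ≤ k := by simpa using hβ
        rw [List.take_of_length_le (by omega)] at hfirst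
        rwa [List.take_of_length_le hlen]
      · exfalso
        apply hmin
        rw [Nat.succ_eq_add_one, hsucc k _ hβ] at hfirst
        simp at hfirst
        omega
      · rfl
    let Q : ℕ → Prop := fun m => β[m]? = some Step.E ∧
      i ≤ (β.take (m + 1)).count Step.E ∧ (β.take (m + 1)).count Step.N < j
    have hQk : Q k := ⟨hkE, hfirst⟩
    have hlt : ∀ m, Q m → m < β.length := fun m hm => (List.getElem?_eq_some_iff.1 hm.1).1
    have hQ : Q (Nat.findGreatest Q β.length) := Nat.findGreatest_spec (hlt k hQk).le hQk
    have hmax : ∀ m, Q m → m ≤ Nat.findGreatest Q β.length :=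
      fun m hm => Nat.le_findGreatest (hlt m hm).le hm
    generalize Nat.findGreatest Q β.length = m at hQ hmax
    obtain ⟨hmE, h1, h2⟩ := hQ
    rcases hβ : β[m + 1]? with _ | ⟨_ | _⟩
    · have hlen : β.length = m + 1 := by
        have := hlt m ⟨hmE, h1, h2⟩
        have : β.length ≤ m + 1 := by simpa using hβ
        omega
      rw [List.take_of_length_le hlen.le] at h1 h2
      refine ⟨_, _, Or.inr ⟨?_, rfl, rfl⟩, h1, h2⟩
      rw [List.getLast?_eq_getElem?, hlen]
      exact hmE
    · refine ⟨_, _, Or.inl ⟨m, hmE, hβ, rfl, rfl⟩, ?_, h2⟩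
      rw [hsucc m _ hmE] at h1
      simpa using h1
    · exfalso
      have hQ' : Q (m + 1) := by
        refine ⟨hβ, ?_, ?_⟩ <;> rw [hsucc (m + 1) _ hβ] <;> simp <;> omega
      have := hmax _ hQ'
      omega

/-- The position of a valley, as a pair of step counts of a prefix. -/
theorem IsValley.exists_take {β : List Step} {i j : ℕ} (h : IsValley β i j) :
    ∃ k, (β.take k).count Step.E = i ∧ (β.take k).count Step.N + 1 = j ∧ 1 ≤ i := by
  rcases h with ⟨p, hE, -, rfl, rfl⟩ | ⟨hl, rfl, rfl⟩
  · refine ⟨p + 1, ?_, rfl, by omega⟩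
    rw [List.take_add_one, hE]
    simp
  · refine ⟨β.length, by simp, by simp, ?_⟩
    exact List.count_pos_iff.2 (List.mem_of_getLast? hl)

theorem count_E_add_count_N (β : List Step) :
    β.count Step.E + β.count Step.N = β.length := by
  induction β with
  | nil => rfl
  | cons x l ih => cases x <;> simp <;> omega

/-! ### Roots as cells -/

/-- The unit vectors `e_n, …, e_1, -e_1, …, -e_n`, indexed from `1` to `2n`. -/
def cellVec (n k : ℕ) : Fin n → ℤ := if k ≤ n then eI n (n + 1 - k) else -eI n (k - n)

theorem rootOfValleyC_eq {n i : ℕ} (j : ℕ) (hi : i ≤ n) :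
    rootOfValleyC n i j = cellVec n i - cellVec n j := by
  unfold rootOfValleyC cellVec
  split_ifs <;> simp

theorem cellVec_sub_mem_posRootsC {n i j : ℕ} (hi : 1 ≤ i) (hij : i < j) (hj : j ≤ 2 * n) :
    cellVec n i - cellVec n j ∈ PosRootsC n := by
  unfold cellVec
  split_ifs with h1 h2 h2
  · exact Or.inl ⟨n + 1 - j, n + 1 - i, by omega, by omega, by omega, Or.inl rfl⟩
  · rw [sub_neg_eq_add]
    rcases lt_trichotomy (n + 1 - i) (j - n) with h | h | h
    · exact Or.inl ⟨n + 1 - i, j - n, by omega, h, by omega, Or.inr (add_comm _ _)⟩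
    · exact Or.inr ⟨j - n, by omega, by omega, by rw [h, two_smul]⟩
    · exact Or.inl ⟨j - n, n + 1 - i, by omega, h, by omega, Or.inr rfl⟩
  · omega
  · exact Or.inl ⟨i - n, j - n, by omega, by omega, by omega, Or.inl (by abel)⟩

/-- The sum of the last `m` coordinates. -/
def topSum (n m : ℕ) : (Fin n → ℤ) →+ ℤ where
  toFun x := ∑ t : Fin n, if n ≤ t.val + m then x t else 0
  map_zero' := by simp
  map_add' x y := by
    rw [← Finset.sum_add_distrib]
    exact Finset.sum_congr rfl fun t _ => by split_ifs <;> simp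

theorem topSum_eI {n m k : ℕ} (hk : 1 ≤ k) (hkn : k ≤ n) :
    topSum n m (eI n k) = if n + 1 ≤ k + m then 1 else 0 := by
  have h : ∀ t : Fin n, (if n ≤ t.val + m then eI n k t else 0) =
      if t = (⟨k - 1, by omega⟩ : Fin n) then (if n + 1 ≤ k + m then 1 else 0) else 0 := by
    intro t
    simp only [eI, Fin.ext_iff]
    split_ifs <;> first | rfl | omega
  change ∑ t : Fin n, (if n ≤ t.val + m then eI n k t else 0) = _
  simp only [h, Finset.sum_ite_eq', Finset.mem_univ, if_true]

theorem topSum_cellVec {n m k : ℕ} (hk : 1 ≤ k) (hkn : k ≤ 2 * n) (hm : m ≤ n) :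
    topSum n m (cellVec n k) =
      (if k ≤ m then 1 else 0) - (if 2 * n + 1 ≤ k + m then 1 else 0) := by
  unfold cellVec
  split_ifs with h1 <;> first
    | omega
    | rw [topSum_eI (by omega) (by omega)]; split_ifs <;> omega
    | rw [map_neg, topSum_eI (by omega) (by omega)]; split_ifs <;> omega

theorem topSum_nonneg_of_mem_closure {n : ℕ} (m : ℕ) {x : Fin n → ℤ}
    (hx : x ∈ AddSubmonoid.closure (PosRootsC n)) : 0 ≤ topSum n m x := by
  induction hx using AddSubmonoid.closure_induction with
  | mem x hx =>
    rcases hx with ⟨i, j, hi, hij, hj, rfl | rfl⟩ | ⟨i, hi, hin, rfl⟩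
    · rw [map_sub, topSum_eI (by omega) (by omega), topSum_eI (by omega) (by omega)]
      split_ifs <;> omega
    · rw [map_add, topSum_eI (by omega) (by omega), topSum_eI (by omega) (by omega)]
      split_ifs <;> omega
    · rw [map_zsmul, topSum_eI (by omega) (by omega)]
      split_ifs <;> simp
  | zero => simp
  | add x y _ _ hx hy => rw [map_add]; exact add_nonneg hx hy

/-- The root poset order on the cells of the fundamental triangle. -/
theorem rootLE_cellVec_iff {n i j i' j' : ℕ} (hi : 1 ≤ i) (hij : i < j) (hs : i + j ≤ 2 * n + 1)
    (hi' : 1 ≤ i') (hij' : i' < j') (hs' : i' + j' ≤ 2 * n + 1) :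
    rootLE n (cellVec n i - cellVec n j) (cellVec n i' - cellVec n j') ↔ i' ≤ i ∧ j ≤ j' := by
  unfold rootLE
  constructor
  · intro h
    have key : ∀ m, m ≤ n → 0 ≤
        ((if i' ≤ m then 1 else 0) - (if 2 * n + 1 ≤ i' + m then 1 else 0)) -
        ((if j' ≤ m then 1 else 0) - (if 2 * n + 1 ≤ j' + m then 1 else 0)) -
        (((if i ≤ m then 1 else 0) - (if 2 * n + 1 ≤ i + m then 1 else 0)) -
        ((if j ≤ m then 1 else 0) - (if 2 * n + 1 ≤ j + m then 1 else 0)) : ℤ) := by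
      intro m hm
      have := topSum_nonneg_of_mem_closure m h
      simpa only [map_sub, topSum_cellVec hi (by omega : i ≤ 2 * n) hm,
        topSum_cellVec (by omega : 1 ≤ j) (by omega : j ≤ 2 * n) hm,
        topSum_cellVec hi' (by omega : i' ≤ 2 * n) hm,
        topSum_cellVec (by omega : 1 ≤ j') (by omega : j' ≤ 2 * n) hm] using this
    have h1 : i' ≤ i := by
      by_contra hlt
      have := key i (by omega)
      rw [if_neg hlt, if_neg (by omega : ¬ j' ≤ i), if_pos le_rfl,
        if_neg (by omega : ¬ j ≤ i), if_neg (by omega : ¬ 2 * n + 1 ≤ i + i),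
        if_neg (by omega : ¬ 2 * n + 1 ≤ j' + i)] at this
      split_ifs at this <;> omega
    refine ⟨h1, ?_⟩
    by_contra hlt
    by_cases hjn : j ≤ n
    · have := key (j - 1) (by omega)
      rw [if_pos (by omega : i' ≤ j - 1), if_pos (by omega : j' ≤ j - 1),
        if_pos (by omega : i ≤ j - 1), if_neg (by omega : ¬ j ≤ j - 1),
        if_neg (by omega : ¬ 2 * n + 1 ≤ j' + (j - 1)),
        if_neg (by omega : ¬ 2 * n + 1 ≤ i + (j - 1)),
        if_neg (by omega : ¬ 2 * n + 1 ≤ i' + (j - 1)),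
        if_neg (by omega : ¬ 2 * n + 1 ≤ j + (j - 1))] at this
      omega
    · have := key (2 * n + 1 - j) (by omega)
      rw [if_pos (by omega : i' ≤ 2 * n + 1 - j),
        if_neg (by omega : ¬ 2 * n + 1 ≤ j' + (2 * n + 1 - j)),
        if_pos (by omega : i ≤ 2 * n + 1 - j),
        if_neg (by omega : ¬ 2 * n + 1 ≤ i + (2 * n + 1 - j)),
        if_neg (by omega : ¬ j ≤ 2 * n + 1 - j),
        if_pos (by omega : 2 * n + 1 ≤ j + (2 * n + 1 - j))] at this
      split_ifs at this <;> omega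
  · rintro ⟨h1, h2⟩
    have hmem : ∀ p q : ℕ, 1 ≤ p → p ≤ q → q ≤ 2 * n →
        cellVec n p - cellVec n q ∈ AddSubmonoid.closure (PosRootsC n) := by
      intro p q hp hpq hq
      rcases hpq.eq_or_lt with rfl | hlt
      · simp
      · exact AddSubmonoid.subset_closure (cellVec_sub_mem_posRootsC hp hlt hq)
    have := add_mem (hmem i' i hi' h1 (by omega)) (hmem j j' (by omega) h2 (by omega))
    convert this using 1
    abel

/-! ### The action of signed permutations on roots -/

/-- The vector `sgn(z) e_{|z|}`. -/
def signedVec (n : ℕ) (z : ℤ) : Fin n → ℤ :=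
  fun k => if z = k.val + 1 then 1 else if z = -(k.val + 1) then -1 else 0

theorem signedVec_natCast (n k : ℕ) : signedVec n (k : ℤ) = eI n k := by
  funext t
  simp only [signedVec, eI]
  split_ifs <;> omega

theorem signedVec_neg (n : ℕ) (z : ℤ) : signedVec n (-z) = -signedVec n z := by
  funext t
  simp only [signedVec, Pi.neg_apply]
  split_ifs <;> omega

theorem actSP_add (n : ℕ) (w x y : Fin n → ℤ) :
    actSP n w (x + y) = actSP n w x + actSP n w y := by
  funext k
  simp only [actSP, Pi.add_apply, ← Finset.sum_add_distrib]
  exact Finset.sum_congr rfl fun i _ => by split_ifs <;> ring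

theorem actSP_sub (n : ℕ) (w x y : Fin n → ℤ) :
    actSP n w (x - y) = actSP n w x - actSP n w y := by
  funext k
  simp only [actSP, Pi.sub_apply, ← Finset.sum_sub_distrib]
  exact Finset.sum_congr rfl fun i _ => by split_ifs <;> ring

theorem actSP_eI {n : ℕ} {w : Fin n → ℤ} (hw : ∀ i, w i ≠ 0) (t : Fin n) :
    actSP n w (eI n (t.val + 1)) = signedVec n (w t) := by
  funext k
  have h : ∀ i : Fin n, (if |w i| = (k.val : ℤ) + 1 then
      (w i).sign * eI n (t.val + 1) i else 0) =
      if i = t then (if |w t| = (k.val : ℤ) + 1 then (w t).sign else 0) else 0 := by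
    intro i
    by_cases hit : i = t
    · subst hit
      simp [eI]
    · have : i.val ≠ t.val := fun h => hit (Fin.ext h)
      simp [eI, hit, this]
  simp only [actSP, h, Finset.sum_ite_eq', Finset.mem_univ, if_true, signedVec]
  rcases lt_or_gt_of_ne (hw t) with hneg | hpos
  · rw [Int.sign_eq_neg_one_of_neg hneg, abs_of_neg hneg]
    split_ifs <;> omega
  · rw [Int.sign_eq_one_of_pos hpos, abs_of_pos hpos]
    split_ifs <;> omega

/-- The linear functional `x ↦ ∑ k x_k`, positive on positive roots. -/
def weightedSum (n : ℕ) : (Fin n → ℤ) →+ ℤ where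
  toFun x := ∑ t : Fin n, ((t.val : ℤ) + 1) * x t
  map_zero' := by simp
  map_add' x y := by
    rw [← Finset.sum_add_distrib]
    exact Finset.sum_congr rfl fun t _ => by simp only [Pi.add_apply]; ring

theorem weightedSum_eI {n k : ℕ} (hk : 1 ≤ k) (hkn : k ≤ n) : weightedSum n (eI n k) = k := by
  have h : ∀ t : Fin n, ((t.val : ℤ) + 1) * eI n k t =
      if t = (⟨k - 1, by omega⟩ : Fin n) then (k : ℤ) else 0 := by
    intro t
    simp only [eI, Fin.ext_iff]
    split_ifs <;> omega
  change ∑ t : Fin n, ((t.val : ℤ) + 1) * eI n k t = _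
  simp only [h, Finset.sum_ite_eq', Finset.mem_univ, if_true]

theorem weightedSum_signedVec {n : ℕ} {z : ℤ} (hz : 1 ≤ |z|) (hzn : |z| ≤ n) :
    weightedSum n (signedVec n z) = z := by
  obtain ⟨k, rfl | rfl⟩ := z.eq_nat_or_neg
  · rw [Nat.abs_cast] at hz hzn
    rw [signedVec_natCast, weightedSum_eI (by omega) (by omega)]
  · rw [abs_neg, Nat.abs_cast] at hz hzn
    rw [signedVec_neg, map_neg, signedVec_natCast, weightedSum_eI (by omega) (by omega)]

theorem weightedSum_pos {n : ℕ} {x : Fin n → ℤ} (hx : x ∈ PosRootsC n) :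
    0 < weightedSum n x := by
  rcases hx with ⟨i, j, hi, hij, hj, rfl | rfl⟩ | ⟨i, hi, hin, rfl⟩
  · rw [map_sub, weightedSum_eI (by omega) (by omega), weightedSum_eI (by omega) (by omega)]
    omega
  · rw [map_add, weightedSum_eI (by omega) (by omega), weightedSum_eI (by omega) (by omega)]
    omega
  · rw [map_zsmul, weightedSum_eI (by omega) (by omega), smul_eq_mul]
    omega

theorem signedVec_sub_mem_posRootsC_iff {n : ℕ} {x y : ℤ} (hx : 1 ≤ |x|) (hxn : |x| ≤ n)
    (hy : 1 ≤ |y|) (hyn : |y| ≤ n) : signedVec n x - signedVec n y ∈ PosRootsC n ↔ y < x := by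
  constructor
  · intro h
    have := weightedSum_pos h
    rw [map_sub, weightedSum_signedVec hx hxn, weightedSum_signedVec hy hyn] at this
    omega
  · intro h
    obtain ⟨k, rfl | rfl⟩ := x.eq_nat_or_neg <;> obtain ⟨l, rfl | rfl⟩ := y.eq_nat_or_neg <;>
      simp only [abs_neg, Nat.abs_cast] at hx hxn hy hyn <;>
      simp only [signedVec_neg, signedVec_natCast, sub_neg_eq_add]
    · exact Or.inl ⟨l, k, by omega, by omega, by omega, Or.inl rfl⟩
    · rcases lt_trichotomy k l with hkl | rfl | hkl
      · exact Or.inl ⟨k, l, by omega, hkl, by omega, Or.inr (add_comm _ _)⟩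
      · exact Or.inr ⟨k, by omega, by omega, by rw [two_smul]⟩
      · exact Or.inl ⟨l, k, by omega, hkl, by omega, Or.inr rfl⟩
    · omega
    · exact Or.inl ⟨k, l, by omega, by omega, by omega, Or.inl (by abel)⟩

theorem actSP_sub_mem_posRootsC_iff {n : ℕ} {w : Fin n → ℤ} (hw : IsSignedPerm n w)
    (s t : Fin n) :
    actSP n w (eI n (t.val + 1) - eI n (s.val + 1)) ∈ PosRootsC n ↔ w s < w t := by
  have h0 : ∀ i, w i ≠ 0 := fun i h => by simpa [h] using (hw.1 i).1
  rw [actSP_sub, actSP_eI h0, actSP_eI h0,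
    signedVec_sub_mem_posRootsC_iff (hw.1 t).1 (hw.1 t).2 (hw.1 s).1 (hw.1 s).2]

theorem actSP_add_mem_posRootsC_iff {n : ℕ} {w : Fin n → ℤ} (hw : IsSignedPerm n w)
    (s t : Fin n) :
    actSP n w (eI n (t.val + 1) + eI n (s.val + 1)) ∈ PosRootsC n ↔ 0 < w s + w t := by
  have h0 : ∀ i, w i ≠ 0 := fun i h => by simpa [h] using (hw.1 i).1
  have hs := hw.1 s
  rw [← abs_neg] at hs
  rw [actSP_add, actSP_eI h0, actSP_eI h0, ← sub_neg_eq_add, ← signedVec_neg,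
    signedVec_sub_mem_posRootsC_iff (hw.1 t).1 (hw.1 t).2 hs.1 hs.2, neg_lt_iff_pos_add']

theorem mem_posRootsC_iff {n : ℕ} {x : Fin n → ℤ} :
    x ∈ PosRootsC n ↔
      (∃ s t : Fin n, s < t ∧ x = eI n (t.val + 1) - eI n (s.val + 1)) ∨
      ∃ s t : Fin n, s ≤ t ∧ x = eI n (t.val + 1) + eI n (s.val + 1) := by
  constructor
  · rintro (⟨i, j, hi, hij, hj, h⟩ | ⟨i, hi, hin, rfl⟩)
    · obtain ⟨s, rfl⟩ : ∃ s, i = s + 1 := ⟨i - 1, by omega⟩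
      obtain ⟨t, rfl⟩ : ∃ t, j = t + 1 := ⟨j - 1, by omega⟩
      rcases h with rfl | rfl
      · exact Or.inl ⟨⟨s, by omega⟩, ⟨t, by omega⟩, Fin.mk_lt_mk.2 (by omega), rfl⟩
      · exact Or.inr ⟨⟨s, by omega⟩, ⟨t, by omega⟩, Fin.mk_le_mk.2 (by omega), rfl⟩
    · obtain ⟨s, rfl⟩ : ∃ s, i = s + 1 := ⟨i - 1, by omega⟩
      exact Or.inr ⟨⟨s, by omega⟩, ⟨s, by omega⟩, le_rfl, two_smul _ _⟩
  · rintro (⟨s, t, hst, rfl⟩ | ⟨s, t, hst, rfl⟩)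
    · rw [Fin.lt_def] at hst
      exact Or.inl ⟨s + 1, t + 1, by omega, by omega, by omega, Or.inl rfl⟩
    · rcases hst.eq_or_lt with rfl | hst
      · exact Or.inr ⟨s + 1, by omega, by omega, (two_smul _ _).symm⟩
      · rw [Fin.lt_def] at hst
        exact Or.inl ⟨s + 1, t + 1, by omega, by omega, by omega, Or.inr rfl⟩

/-- The positive root with parameters `s < t` (difference) or `s ≤ t` (sum). -/
def pairRoot (n : ℕ) : (Fin n × Fin n) ⊕ (Fin n × Fin n) → Fin n → ℤ
  | Sum.inl p => eI n (p.2.val + 1) - eI n (p.1.val + 1)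
  | Sum.inr p => eI n (p.2.val + 1) + eI n (p.1.val + 1)

theorem injOn_pairRoot (n : ℕ) :
    Set.InjOn (pairRoot n) {x | Sum.elim (fun p => p.1 < p.2) (fun p => p.1 ≤ p.2) x} := by
  rintro (⟨s, t⟩ | ⟨s, t⟩) h (⟨s', t'⟩ | ⟨s', t'⟩) h' heq <;>
    simp only [Set.mem_ofPred_eq, Sum.elim_inl, Sum.elim_inr, Fin.lt_def, Fin.le_def] at h h' <;>
    have e1 := congrFun heq s <;> have e2 := congrFun heq t <;>
    have e3 := congrFun heq s' <;> have e4 := congrFun heq t' <;>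
    simp only [pairRoot, eI, Pi.sub_apply, Pi.add_apply, add_left_inj] at e1 e2 e3 e4
  · simp only [Sum.inl.injEq, Prod.mk.injEq, Fin.ext_iff]
    grind
  · exfalso
    grind
  · exfalso
    grind
  · simp only [Sum.inr.injEq, Prod.mk.injEq, Fin.ext_iff]
    grind

/-! ### Keyed words -/

theorem countP_eq_card {α : Type*} [DecidableEq α] {T : List α} (hT : T.Nodup) (P : α → Prop)
    [DecidablePred P] {s : Finset α} (h : ∀ x, x ∈ s ↔ x ∈ T ∧ P x) :
    T.countP (fun x => decide (P x)) = s.card := by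
  rw [List.countP_eq_length_filter, ← List.toFinset_card_of_nodup (hT.filter _)]
  congr 1
  ext x
  simp [h]

section KeyedList

variable {K : Type*} [LinearOrder K] {T : List (Step × K)}

theorem exists_key_of_take (hT : T.Pairwise fun x y => x.2 < y.2) (k : ℕ)
    (hk : (T.map Prod.fst).take k ≠ []) :
    ∃ c, ∀ s, ((T.map Prod.fst).take k).count s =
      T.countP fun x => decide (x.1 = s ∧ x.2 ≤ c) := by
  rw [← List.map_take] at hk ⊢
  have hne : T.take k ≠ [] := by simpa using hk
  rw [← List.take_append_drop k T] at hT
  obtain ⟨h1, -, h3⟩ := List.pairwise_append.1 hT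
  have hle : ∀ x ∈ T.take k, x.2 ≤ ((T.take k).getLast hne).2 := by
    intro x hx
    rw [← List.dropLast_append_getLast hne] at hx h1
    rcases List.mem_append.1 hx with hx | hx
    · exact ((List.pairwise_append.1 h1).2.2 x hx _ (by simp)).le
    · rw [List.mem_singleton.1 hx]
  have hgt : ∀ x ∈ T.drop k, ((T.take k).getLast hne).2 < x.2 :=
    h3 _ (List.getLast_mem hne)
  generalize ((T.take k).getLast hne).2 = c at hle hgt
  refine ⟨c, fun s => ?_⟩
  conv_rhs => rw [← List.take_append_drop k T]
  rw [List.countP_append, (List.countP_eq_zero (l := T.drop k)).2, add_zero, List.count,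
    List.countP_map]
  · refine List.countP_congr fun x hx => ?_
    simp [hle x hx]
  · intro x hx
    simp [hgt x hx]

theorem exists_take_of_key (hT : T.Pairwise fun x y => x.2 < y.2) (c : K) :
    ∃ k, ∀ s, ((T.map Prod.fst).take k).count s =
      T.countP fun x => decide (x.1 = s ∧ x.2 ≤ c) := by
  induction T with
  | nil => exact ⟨0, by simp⟩
  | cons y T ih =>
    rw [List.pairwise_cons] at hT
    by_cases hy : y.2 ≤ c
    · obtain ⟨k, hk⟩ := ih hT.2
      refine ⟨k + 1, fun s => ?_⟩
      rw [List.map_cons, List.take_succ_cons, List.count_cons, hk, List.countP_cons]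
      simp [hy]
    · refine ⟨0, fun s => ?_⟩
      rw [List.take_zero, List.count_nil, List.countP_eq_zero.2]
      intro x hx
      rcases List.mem_cons.1 hx with rfl | hx
      · simpa using fun _ => not_le.1 hy
      · have := (not_le.1 hy).trans (hT.1 x hx)
        simp [this]

end KeyedList

/-! ### Keys of the letters of the zeta image -/

section Keys

variable {n : ℕ}

/-- The position key of the first North step contributed by the entry `a p`. -/
def nKey (a : Fin n → ℤ) (p : Fin n) : ℤ ×ₗ ℤ :=
  toLex (if a p ≤ 0 then (2 * a p, (p.val : ℤ)) else (1 - 2 * a p, -(p.val : ℤ)))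

/-- The position key of the East step contributed by the entry `a p`. -/
def eKey (a : Fin n → ℤ) (p : Fin n) : ℤ ×ₗ ℤ :=
  toLex (if a p ≤ 0 then (2 * a p + 2, (p.val : ℤ)) else (3 - 2 * a p, -(p.val : ℤ)))

/-- The position key of the second North step contributed by a zero entry `p`. -/
def zKey (p : Fin n) : ℤ ×ₗ ℤ := toLex (1, -(p.val : ℤ))

theorem nKey_injective (a : Fin n → ℤ) : Function.Injective (nKey a) := by
  intro p q h
  simp only [nKey, toLex_inj] at h
  rw [Fin.ext_iff]
  split_ifs at h <;> simp only [Prod.mk.injEq] at h <;> omega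

theorem eKey_injective (a : Fin n → ℤ) : Function.Injective (eKey a) := by
  intro p q h
  simp only [eKey, toLex_inj] at h
  rw [Fin.ext_iff]
  split_ifs at h <;> simp only [Prod.mk.injEq] at h <;> omega

theorem zKey_injective : Function.Injective (zKey (n := n)) := by
  intro p q h
  simp only [zKey, toLex_inj, Prod.mk.injEq] at h
  rw [Fin.ext_iff]
  omega

theorem eKey_le_eKey_iff (a : Fin n → ℤ) (p q : Fin n) :
    eKey a p ≤ eKey a q ↔ nKey a p ≤ nKey a q := by
  simp only [eKey, nKey, Prod.Lex.toLex_le_toLex]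
  split_ifs <;> omega

theorem nKey_lt_eKey (a : Fin n → ℤ) (p : Fin n) : nKey a p < eKey a p := by
  simp only [eKey, nKey, Prod.Lex.toLex_lt_toLex]
  split_ifs <;> omega

theorem nKey_lt_zKey (a : Fin n → ℤ) (p q : Fin n) : nKey a p < zKey q := by
  simp only [zKey, nKey, Prod.Lex.toLex_lt_toLex]
  split_ifs <;> simp only <;> omega

theorem eq_zero_of_nKey_le {a : Fin n → ℤ} {p q : Fin n} (hp : a p = 0)
    (h : nKey a p ≤ nKey a q) : a q = 0 := by
  simp only [nKey, hp, Prod.Lex.toLex_le_toLex] at h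
  split_ifs at h <;> simp only at h <;> omega

theorem zKey_le_zKey_iff {a : Fin n → ℤ} {p q : Fin n} (hp : a p = 0) (hq : a q = 0) :
    zKey p ≤ zKey q ↔ nKey a q ≤ nKey a p := by
  simp only [nKey, zKey, hp, hq, Prod.Lex.toLex_le_toLex]
  simp

/-- The key in the negative (`false`) or positive (`true`) half of level `j`. -/
def blockKey (j : ℕ) (b : Bool) (p : Fin n) : ℤ ×ₗ ℤ :=
  if b then toLex (1 - 2 * (j : ℤ), -(p.val : ℤ)) else toLex (-2 * (j : ℤ), (p.val : ℤ))

/-- The negative half of level `j` of the zeta image, with keys. -/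
def minusBlock (a : Fin n → ℤ) (j : ℕ) : List (Step × (ℤ ×ₗ ℤ)) :=
  (List.finRange n).filterMap fun p =>
    if a p = -(j : ℤ) then some (Step.N, blockKey j false p)
    else if a p = -(j : ℤ) - 1 then some (Step.E, blockKey j false p) else none

/-- The positive half of level `j` of the zeta image, with keys. -/
def plusBlock (a : Fin n → ℤ) (j : ℕ) : List (Step × (ℤ ×ₗ ℤ)) :=
  (List.finRange n).reverse.filterMap fun p =>
    if a p = (j : ℤ) then some (Step.N, blockKey j true p)
    else if a p = (j : ℤ) + 1 then some (Step.E, blockKey j true p) else none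

/-- The zeta image with keys. -/
def keyedZeta (a : Fin n → ℤ) : List (Step × (ℤ ×ₗ ℤ)) :=
  ((List.range (n + 1)).reverse.map fun j => minusBlock a j ++ plusBlock a j).flatten

theorem mem_minusBlock {a : Fin n → ℤ} {j : ℕ} {x : Step × (ℤ ×ₗ ℤ)} :
    x ∈ minusBlock a j ↔ ∃ p, x.2 = blockKey j false p ∧
      (a p = -(j : ℤ) ∧ x.1 = Step.N ∨ a p = -(j : ℤ) - 1 ∧ x.1 = Step.E) := by
  obtain ⟨s, c⟩ := x
  simp only [minusBlock, List.mem_filterMap, List.mem_finRange, true_and]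
  refine exists_congr fun p => ?_
  split_ifs with h1 h2
  all_goals grind

theorem mem_plusBlock {a : Fin n → ℤ} {j : ℕ} {x : Step × (ℤ ×ₗ ℤ)} :
    x ∈ plusBlock a j ↔ ∃ p, x.2 = blockKey j true p ∧
      (a p = (j : ℤ) ∧ x.1 = Step.N ∨ a p = (j : ℤ) + 1 ∧ x.1 = Step.E) := by
  obtain ⟨s, c⟩ := x
  simp only [plusBlock, List.mem_filterMap, List.mem_reverse, List.mem_finRange, true_and]
  refine exists_congr fun p => ?_
  split_ifs with h1 h2
  all_goals grind

theorem mem_keyedZeta {a : Fin n → ℤ} {x : Step × (ℤ ×ₗ ℤ)} :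
    x ∈ keyedZeta a ↔ ∃ j ≤ n, x ∈ minusBlock a j ∨ x ∈ plusBlock a j := by
  simp only [keyedZeta, List.mem_flatten, List.mem_map, List.mem_reverse, List.mem_range]
  constructor
  · rintro ⟨l, ⟨j, hj, rfl⟩, hx⟩
    exact ⟨j, by omega, List.mem_append.1 hx⟩
  · rintro ⟨j, hj, hx⟩
    exact ⟨_, ⟨j, by omega, rfl⟩, List.mem_append.2 hx⟩

theorem mem_keyedZeta_E {a : Fin n → ℤ} (ha : ∀ p, |a p| ≤ n) {c : ℤ ×ₗ ℤ} :
    (Step.E, c) ∈ keyedZeta a ↔ ∃ p, a p ≠ 0 ∧ eKey a p = c := by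
  simp only [mem_keyedZeta, mem_minusBlock, mem_plusBlock, reduceCtorEq, and_false, false_or,
    and_true]
  constructor
  · rintro ⟨j, hj, ⟨p, rfl, hp⟩ | ⟨p, rfl, hp⟩⟩
    · refine ⟨p, by omega, ?_⟩
      rw [eKey, if_pos (by omega), hp, blockKey]
      simp only [Bool.false_eq_true, if_false, toLex_inj, Prod.mk.injEq, and_true]
      ring
    · refine ⟨p, by omega, ?_⟩
      rw [eKey, if_neg (by omega), hp, blockKey]
      simp only [if_true, toLex_inj, Prod.mk.injEq, and_true]
      ring
  · rintro ⟨p, hp, rfl⟩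
    have := abs_le.1 (ha p)
    refine ⟨(a p).natAbs - 1, by omega, ?_⟩
    rcases lt_or_gt_of_ne hp with h | h
    · refine Or.inl ⟨p, ?_, by omega⟩
      rw [eKey, if_pos h.le, blockKey]
      simp only [Bool.false_eq_true, if_false, toLex_inj, Prod.mk.injEq, and_true]
      omega
    · refine Or.inr ⟨p, ?_, by omega⟩
      rw [eKey, if_neg (by omega), blockKey]
      simp only [if_true, toLex_inj, Prod.mk.injEq, and_true]
      omega

theorem mem_keyedZeta_N {a : Fin n → ℤ} (ha : ∀ p, |a p| ≤ n) {c : ℤ ×ₗ ℤ} :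
    (Step.N, c) ∈ keyedZeta a ↔ (∃ p, nKey a p = c) ∨ ∃ p, a p = 0 ∧ zKey p = c := by
  simp only [mem_keyedZeta, mem_minusBlock, mem_plusBlock, reduceCtorEq, and_false, or_false,
    and_true]
  constructor
  · rintro ⟨j, hj, ⟨p, rfl, hp⟩ | ⟨p, rfl, hp⟩⟩
    · refine Or.inl ⟨p, ?_⟩
      rw [nKey, if_pos (by omega), hp, blockKey]
      simp only [Bool.false_eq_true, if_false, toLex_inj, Prod.mk.injEq, and_true]
      ring
    · rcases Nat.eq_zero_or_pos j with rfl | hj0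
      · exact Or.inr ⟨p, by simpa using hp, by simp [zKey, blockKey]⟩
      · refine Or.inl ⟨p, ?_⟩
        rw [nKey, if_neg (by omega), hp, blockKey]
        simp only [if_true]
  · rintro (⟨p, rfl⟩ | ⟨p, hp, rfl⟩)
    · have := abs_le.1 (ha p)
      refine ⟨(a p).natAbs, by omega, ?_⟩
      rcases le_or_gt (a p) 0 with h | h
      · refine Or.inl ⟨p, ?_, by omega⟩
        rw [nKey, if_pos h, blockKey]
        simp only [Bool.false_eq_true, if_false, toLex_inj, Prod.mk.injEq, and_true]
        omega
      · refine Or.inr ⟨p, ?_, by omega⟩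
        rw [nKey, if_neg (by omega), blockKey]
        simp only [if_true, toLex_inj, Prod.mk.injEq, and_true]
        omega
    · exact ⟨0, by omega, Or.inr ⟨p, by simp [zKey, blockKey], by simpa using hp⟩⟩

theorem pairwise_keyedZeta (a : Fin n → ℤ) :
    (keyedZeta a).Pairwise fun x y => x.2 < y.2 := by
  rw [keyedZeta, List.pairwise_flatten]
  constructor
  · intro l hl
    obtain ⟨j, -, rfl⟩ := List.mem_map.1 hl
    refine List.pairwise_append.2 ⟨?_, ?_, ?_⟩
    · rw [minusBlock, List.pairwise_filterMap]
      refine (List.pairwise_lt_finRange n).imp fun {p q} hpq x hx y hy => ?_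
      have h1 : x.2 = blockKey j false p := by split_ifs at hx <;> cases hx <;> rfl
      have h2 : y.2 = blockKey j false q := by split_ifs at hy <;> cases hy <;> rfl
      rw [h1, h2, blockKey, blockKey]
      simpa [Prod.Lex.toLex_lt_toLex] using hpq
    · rw [plusBlock, List.pairwise_filterMap, List.pairwise_reverse]
      refine (List.pairwise_lt_finRange n).imp fun {p q} hpq x hx y hy => ?_
      have h1 : x.2 = blockKey j true q := by split_ifs at hx <;> cases hx <;> rfl
      have h2 : y.2 = blockKey j true p := by split_ifs at hy <;> cases hy <;> rfl
      rw [h1, h2, blockKey, blockKey]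
      simpa [Prod.Lex.toLex_lt_toLex] using hpq
    · intro x hx y hy
      obtain ⟨p, hp, -⟩ := mem_minusBlock.1 hx
      obtain ⟨q, hq, -⟩ := mem_plusBlock.1 hy
      rw [hp, hq, blockKey, blockKey]
      simp only [Bool.false_eq_true, if_false, if_true, Prod.Lex.toLex_lt_toLex]
      omega
  · rw [List.pairwise_map, List.pairwise_reverse]
    refine List.pairwise_lt_range.imp fun {i j} hij x hx y hy => ?_
    have h1 : ∃ b p, x.2 = blockKey (n := n) j b p := by
      rcases List.mem_append.1 hx with hx | hx
      · obtain ⟨p, hp, -⟩ := mem_minusBlock.1 hx; exact ⟨_, _, hp⟩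
      · obtain ⟨p, hp, -⟩ := mem_plusBlock.1 hx; exact ⟨_, _, hp⟩
    have h2 : ∃ b p, y.2 = blockKey (n := n) i b p := by
      rcases List.mem_append.1 hy with hy | hy
      · obtain ⟨p, hp, -⟩ := mem_minusBlock.1 hy; exact ⟨_, _, hp⟩
      · obtain ⟨p, hp, -⟩ := mem_plusBlock.1 hy; exact ⟨_, _, hp⟩
    obtain ⟨b, p, h1⟩ := h1
    obtain ⟨b', q, h2⟩ := h2
    rw [h1, h2, blockKey, blockKey]
    cases b <;> cases b' <;>
      simp only [Bool.false_eq_true, if_false, if_true, Prod.Lex.toLex_lt_toLex] <;> omega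

theorem nodup_keyedZeta (a : Fin n → ℤ) : (keyedZeta a).Nodup :=
  (pairwise_keyedZeta a).imp fun h he => h.ne (congrArg Prod.snd he)

theorem countP_keyedZeta_E {a : Fin n → ℤ} (ha : ∀ p, |a p| ≤ n) (c : ℤ ×ₗ ℤ) :
    (keyedZeta a).countP (fun x => decide (x.1 = Step.E ∧ x.2 ≤ c)) =
      (Finset.univ.filter fun p => a p ≠ 0 ∧ eKey a p ≤ c).card := by
  have hinj : Function.Injective fun p => (Step.E, eKey a p) :=
    fun p q h => eKey_injective a (congrArg Prod.snd h)
  rw [← Finset.card_image_of_injective _ hinj]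
  refine countP_eq_card (nodup_keyedZeta a) (fun x => x.1 = Step.E ∧ x.2 ≤ c) ?_
  rintro ⟨s, d⟩
  simp only [Finset.mem_image, Finset.mem_filter, Finset.mem_univ, true_and, Prod.mk.injEq]
  constructor
  · rintro ⟨p, ⟨h1, h2⟩, rfl, rfl⟩
    exact ⟨(mem_keyedZeta_E ha).2 ⟨p, h1, rfl⟩, rfl, h2⟩
  · rintro ⟨h, rfl, h2⟩
    obtain ⟨p, hp, rfl⟩ := (mem_keyedZeta_E ha).1 h
    exact ⟨p, ⟨hp, h2⟩, rfl, rfl⟩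

theorem countP_keyedZeta_N {a : Fin n → ℤ} (ha : ∀ p, |a p| ≤ n) (c : ℤ ×ₗ ℤ) :
    (keyedZeta a).countP (fun x => decide (x.1 = Step.N ∧ x.2 ≤ c)) =
      (Finset.univ.filter fun p => nKey a p ≤ c).card +
      (Finset.univ.filter fun p => a p = 0 ∧ zKey p ≤ c).card := by
  have hinj : Function.Injective fun p => (Step.N, nKey a p) :=
    fun p q h => nKey_injective a (congrArg Prod.snd h)
  have hinj' : Function.Injective fun p : Fin n => (Step.N, zKey p) :=
    fun p q h => zKey_injective (congrArg Prod.snd h)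
  rw [← Finset.card_image_of_injective _ hinj, ← Finset.card_image_of_injective _ hinj',
    ← Finset.card_union_of_disjoint]
  · refine countP_eq_card (nodup_keyedZeta a) (fun x => x.1 = Step.N ∧ x.2 ≤ c) ?_
    rintro ⟨s, d⟩
    simp only [Finset.mem_union, Finset.mem_image, Finset.mem_filter, Finset.mem_univ, true_and,
      Prod.mk.injEq]
    constructor
    · rintro (⟨p, h1, rfl, rfl⟩ | ⟨p, ⟨h1, h2⟩, rfl, rfl⟩)
      · exact ⟨(mem_keyedZeta_N ha).2 (Or.inl ⟨p, rfl⟩), rfl, h1⟩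
      · exact ⟨(mem_keyedZeta_N ha).2 (Or.inr ⟨p, h1, rfl⟩), rfl, h2⟩
    · rintro ⟨h, rfl, h2⟩
      rcases (mem_keyedZeta_N ha).1 h with ⟨p, rfl⟩ | ⟨p, hp, rfl⟩
      · exact Or.inl ⟨p, h2, rfl, rfl⟩
      · exact Or.inr ⟨p, ⟨hp, h2⟩, rfl, rfl⟩
  · rw [Finset.disjoint_left]
    intro x hx hx'
    obtain ⟨p, -, rfl⟩ := Finset.mem_image.1 hx
    obtain ⟨q, -, hq⟩ := Finset.mem_image.1 hx'
    exact (nKey_lt_zKey a p q).ne (congrArg Prod.snd hq).symm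

end Keys

/-! ### Comparing the two statistics pair by pair -/

section Pairs

variable {n : ℕ} (a u : Fin n → ℤ)

/-- The sign-corrected label of the entry `p`. -/
def itemLabel (p : Fin n) : ℤ := if a p ≤ 0 then -u p else u p

/-- The pair `(q, p)` gives a difference of unit vectors counted by `areaPrimeC`. -/
def SubPair (q p : Fin n) : Prop :=
  nKey a p < nKey a q ∧ ¬ eKey a p < nKey a q ∧ itemLabel a u q < itemLabel a u p

/-- The pair `(q, p)` gives a sum of unit vectors counted by `areaPrimeC`. -/
def AddPair (q p : Fin n) : Prop :=
  nKey a p ≤ nKey a q ∧ (a q = 0 ∧ ¬ eKey a p < zKey q) ∧ 0 < itemLabel a u q + itemLabel a u p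

theorem subPair_iff_of_lt {i j : Fin n} (hij : i < j) :
    SubPair a u i j ↔
      (a j ≤ 0 ∧ (a i = -a j ∧ 0 < a i ∧ u i < -u j ∨ a i = a j + 1 ∧ a i ≤ 0 ∧ u j < u i)) ∨
      (0 < a j ∧ (a i = a j ∧ u i < u j ∨ a i = -a j + 1 ∧ -u j < u i)) := by
  rw [Fin.lt_def] at hij
  simp only [SubPair, nKey, eKey, itemLabel, Prod.Lex.toLex_lt_toLex]
  split_ifs <;> simp only <;> omega

theorem subPair_iff_of_gt {i j : Fin n} (hij : i < j) :
    SubPair a u j i ↔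
      (a i ≤ 0 ∧ (a i = a j ∧ u i < u j ∨ a i = -a j ∧ 0 < a j ∧ u i < -u j)) ∨
      (0 < a i ∧ (a i = -a j + 1 ∧ a j ≤ 0 ∧ -u j < u i ∨ a i = a j + 1 ∧ 0 < a j ∧ u j < u i)) := by
  rw [Fin.lt_def] at hij
  simp only [SubPair, nKey, eKey, itemLabel, Prod.Lex.toLex_lt_toLex]
  split_ifs <;> simp only <;> omega

theorem not_addPair_of_lt {i j : Fin n} (hij : i < j) : ¬ AddPair a u i j := by
  rw [Fin.lt_def] at hij
  simp only [AddPair, nKey, eKey, zKey, itemLabel, Prod.Lex.toLex_lt_toLex,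
    Prod.Lex.toLex_le_toLex]
  split_ifs <;> simp only <;> omega

theorem addPair_iff_of_gt {i j : Fin n} (hij : i < j) :
    AddPair a u j i ↔
      a j = 0 ∧ (a i = 0 ∧ u i < -u j ∨ a i = 1 ∧ u j < u i) := by
  rw [Fin.lt_def] at hij
  simp only [AddPair, nKey, eKey, zKey, itemLabel, Prod.Lex.toLex_lt_toLex,
    Prod.Lex.toLex_le_toLex]
  split_ifs <;> simp only <;> omega

theorem not_subPair_self (i : Fin n) : ¬ SubPair a u i i := fun h => lt_irrefl _ h.1

theorem addPair_self_iff (i : Fin n) : AddPair a u i i ↔ a i = 0 ∧ u i < 0 := by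
  simp only [AddPair, nKey, eKey, zKey, itemLabel, Prod.Lex.toLex_lt_toLex, le_refl,
    true_and]
  split_ifs <;> simp only <;> omega

open Classical in
/-- The contribution of an ordered pair to `areaPrimeC`. -/
noncomputable def areaTerm (i j : Fin n) : ℕ :=
  (if SubPair a u i j then 1 else 0) + (if AddPair a u i j then 1 else 0)

/-- The contribution of an ordered pair to `dinvPrimeC`. -/
def dinvTerm (i j : Fin n) : ℕ :=
  (if i < j ∧ a i = a j ∧ u i < u j then 1 else 0) +
  (if i < j ∧ a i = a j + 1 ∧ u j < u i then 1 else 0) +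
  (if i < j ∧ a i = -a j ∧ u i < -u j then 1 else 0) +
  (if i < j ∧ a i = -a j + 1 ∧ -u j < u i then 1 else 0) +
  (if i = j ∧ a i = 0 ∧ u i < 0 then 1 else 0)

theorem areaTerm_add_swap_of_lt {i j : Fin n} (hij : i < j) :
    areaTerm a u i j + areaTerm a u j i = dinvTerm a u i j + dinvTerm a u j i := by
  simp only [areaTerm, dinvTerm, subPair_iff_of_lt a u hij, subPair_iff_of_gt a u hij,
    not_addPair_of_lt a u hij, addPair_iff_of_gt a u hij, hij, hij.not_gt, hij.ne, hij.ne',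
    true_and, false_and, if_false, add_zero]
  generalize a i = x, a j = y, u i = v, u j = w
  rcases le_or_gt x 0 with hx | hx <;> rcases le_or_gt y 0 with hy | hy
  · simp only [hx, hy, hx.not_gt, hy.not_gt, true_and, false_and, and_false, or_false, false_or]
    split_ifs <;> omega
  · simp only [hx, hy, hx.not_gt, hy.not_ge, true_and, false_and, and_false, or_false, false_or]
    split_ifs <;> omega
  · simp only [hx, hy, hx.not_ge, hy.not_gt, true_and, false_and, and_false, or_false, false_or]
    split_ifs <;> omega
  · simp only [hx, hy, hx.not_ge, hy.not_ge, true_and, false_and, and_false, or_false, false_or]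
    split_ifs <;> omega

theorem areaTerm_add_swap (i j : Fin n) :
    areaTerm a u i j + areaTerm a u j i = dinvTerm a u i j + dinvTerm a u j i := by
  rcases lt_trichotomy i j with h | rfl | h
  · exact areaTerm_add_swap_of_lt a u h
  · simp [areaTerm, dinvTerm, not_subPair_self, addPair_self_iff]
  · have := areaTerm_add_swap_of_lt a u h
    omega

theorem sum_areaTerm_eq_sum_dinvTerm :
    ∑ p : Fin n × Fin n, areaTerm a u p.1 p.2 = ∑ p : Fin n × Fin n, dinvTerm a u p.1 p.2 := by
  have hswap : ∀ f : Fin n → Fin n → ℕ,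
      ∑ p : Fin n × Fin n, f p.1 p.2 + ∑ p : Fin n × Fin n, f p.1 p.2 =
        ∑ p : Fin n × Fin n, (f p.1 p.2 + f p.2 p.1) := by
    intro f
    rw [Finset.sum_add_distrib]
    congr 1
    exact (Equiv.sum_comp (Equiv.prodComm (Fin n) (Fin n)) fun p => f p.1 p.2).symm
  have h1 := hswap (areaTerm a u)
  have h2 := hswap (dinvTerm a u)
  have h3 : ∑ p : Fin n × Fin n, (areaTerm a u p.1 p.2 + areaTerm a u p.2 p.1) =
      ∑ p : Fin n × Fin n, (dinvTerm a u p.1 p.2 + dinvTerm a u p.2 p.1) :=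
    Finset.sum_congr rfl fun p _ => areaTerm_add_swap a u p.1 p.2
  omega

end Pairs

theorem dinvPrimeC_eq_sum (n : ℕ) (π : List Step) (u : Fin n → ℤ) :
    dinvPrimeC n π u =
      ∑ p : Fin n × Fin n, dinvTerm (fun i => areaC n π (n - i.val)) u p.1 p.2 := by
  simp only [dinvPrimeC, dinvTerm, Finset.sum_add_distrib, Finset.card_filter]
  congr 1
  rw [Fintype.sum_prod_type]
  refine Finset.sum_congr rfl fun i _ => ?_
  rw [Finset.sum_eq_single i (fun j _ hj => if_neg fun h => hj h.1.symm)
    (fun h => absurd (Finset.mem_univ _) h)]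
  simp

/-! ### The diagonal reading order -/

section Reading

variable {n : ℕ}

/-- The diagonal reading word, recording positions instead of labels. -/
def diagWord (a : Fin n → ℤ) : List (Fin n) :=
  ((List.range (n + 1)).map fun i : ℕ =>
    ((List.finRange n).reverse.filter fun p => decide (a p = -(i : ℤ))) ++
    (List.finRange n).filter fun p => decide (a p = (i : ℤ) + 1)).flatten

theorem bind_pure_natCast (l : List ℕ) :
    (do let a ← l; pure (a : ℤ)) = l.map (fun a : ℕ => (a : ℤ)) := by
  simp [List.map_eq_flatMap]

theorem filterMap_ite_eq_map_filter {α β : Type*} (P : α → Prop) [DecidablePred P] (f g : α → β)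
    (h : ∀ x, P x → f x = g x) (l : List α) :
    (l.filterMap fun x => if P x then some (f x) else none) =
      (l.filter fun x => decide (P x)).map g := by
  induction l with
  | nil => rfl
  | cons x l ih => by_cases hx : P x <;> simp [hx, ih, h]

theorem dCList_eq_map_diagWord (π : List Step) (u : Fin n → ℤ) :
    dCList n π u = (diagWord fun p : Fin n => areaC n π (n - p.val)).map
      (itemLabel (fun p : Fin n => areaC n π (n - p.val)) u) := by
  rw [dCList, bind_pure_natCast, diagWord, List.map_flatten, List.map_map, List.map_map]
  congr 1
  refine List.map_congr_left fun i _ => ?_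
  rw [Function.comp_apply, Function.comp_apply, List.map_append]
  congr 1
  · refine filterMap_ite_eq_map_filter _ _ _ (fun p hp => ?_) _
    rw [itemLabel, if_pos (by omega)]
  · refine filterMap_ite_eq_map_filter _ _ _ (fun p hp => ?_) _
    rw [itemLabel, if_neg (by omega)]

theorem mem_diagWord {a : Fin n → ℤ} (ha : ∀ p, |a p| ≤ n) (p : Fin n) : p ∈ diagWord a := by
  have := abs_le.1 (ha p)
  simp only [diagWord, List.mem_flatten, List.mem_map, List.mem_range]
  rcases le_or_gt (a p) 0 with h | h
  · refine ⟨_, ⟨(-a p).toNat, by omega, rfl⟩, List.mem_append_left _ ?_⟩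
    simp
    omega
  · refine ⟨_, ⟨(a p - 1).toNat, by omega, rfl⟩, List.mem_append_right _ ?_⟩
    simp
    omega

theorem pairwise_diagWord (a : Fin n → ℤ) :
    (diagWord a).Pairwise fun p q => nKey a q < nKey a p := by
  rw [diagWord, List.pairwise_flatten]
  constructor
  · intro l hl
    obtain ⟨i, -, rfl⟩ := List.mem_map.1 hl
    refine List.pairwise_append.2 ⟨?_, ?_, ?_⟩
    · rw [List.pairwise_filter, List.pairwise_reverse]
      refine (List.pairwise_lt_finRange n).imp fun {p q} hpq hq hp => ?_
      rw [decide_eq_true_iff] at hp hq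
      rw [Fin.lt_def] at hpq
      simp only [nKey, Prod.Lex.toLex_lt_toLex]
      split_ifs <;> simp only <;> omega
    · rw [List.pairwise_filter]
      refine (List.pairwise_lt_finRange n).imp fun {p q} hpq hp hq => ?_
      rw [decide_eq_true_iff] at hp hq
      rw [Fin.lt_def] at hpq
      simp only [nKey, Prod.Lex.toLex_lt_toLex]
      split_ifs <;> simp only <;> omega
    · intro p hp q hq
      have hp := of_decide_eq_true (List.mem_filter.1 hp).2
      have hq := of_decide_eq_true (List.mem_filter.1 hq).2
      simp only [nKey, Prod.Lex.toLex_lt_toLex]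
      split_ifs <;> simp only <;> omega
  · rw [List.pairwise_map]
    refine List.pairwise_lt_range.imp fun {i j} hij p hp q hq => ?_
    have key : ∀ (i : ℕ) (p : Fin n),
        p ∈ ((List.finRange n).reverse.filter fun p => decide (a p = -(i : ℤ))) ++
          (List.finRange n).filter (fun p => decide (a p = (i : ℤ) + 1)) →
        a p = -(i : ℤ) ∨ a p = (i : ℤ) + 1 := by
      intro i p hp
      rcases List.mem_append.1 hp with h | h
      · exact Or.inl (of_decide_eq_true (List.mem_filter.1 h).2)
      · exact Or.inr (of_decide_eq_true (List.mem_filter.1 h).2)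
    have hp := key i p hp
    have hq := key j q hq
    simp only [nKey, Prod.Lex.toLex_lt_toLex]
    split_ifs <;> simp only <;> omega

theorem nodup_diagWord (a : Fin n → ℤ) : (diagWord a).Nodup :=
  (pairwise_diagWord a).imp fun h he => h.ne (by rw [he])

theorem length_diagWord {a : Fin n → ℤ} (ha : ∀ p, |a p| ≤ n) : (diagWord a).length = n := by
  rw [← List.toFinset_card_of_nodup (nodup_diagWord a)]
  have : (diagWord a).toFinset = Finset.univ := by
    ext p
    simp [mem_diagWord ha p]
  rw [this, Finset.card_univ, Fintype.card_fin]

/-- The diagonal reading word lists the labels by decreasing position key. -/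
theorem exists_reading_perm {π : List Step} (u : Fin n → ℤ)
    (ha : ∀ p : Fin n, |areaC n π (n - p.val)| ≤ n) :
    ∃ σ : Equiv.Perm (Fin n),
      StrictAnti (fun t => nKey (fun p : Fin n => areaC n π (n - p.val)) (σ t)) ∧
      ∀ t, dC n π u t = itemLabel (fun p : Fin n => areaC n π (n - p.val)) u (σ t) := by
  generalize hadef : (fun p : Fin n => areaC n π (n - p.val)) = a
  have ha' : ∀ p, |a p| ≤ n := by rw [← hadef]; exact ha
  have hlen := length_diagWord ha'
  let f : Fin n → Fin n := fun t => (diagWord a)[t.val]'(by omega)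
  have hf : StrictAnti fun t => nKey a (f t) := by
    intro s t hst
    exact List.pairwise_iff_getElem.1 (pairwise_diagWord a) s.val t.val _ _ hst
  have hinj : Function.Injective f := fun s t h => hf.injective (congrArg (nKey a) h)
  refine ⟨Equiv.ofBijective f (Finite.injective_iff_bijective.1 hinj), hf, fun t => ?_⟩
  rw [dC, dCList_eq_map_diagWord, hadef, List.getD_eq_getElem _ _ (by simp [hlen])]
  simp [f]

theorem ebn_le_count : ∀ (π : List Step) (k : ℕ), ebn π k ≤ π.count Step.E
  | _, 0 => by simp [ebn]
  | [], k + 1 => by simp [ebn]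
  | Step.E :: rest, k + 1 => by
    have := ebn_le_count rest (k + 1)
    simp only [ebn, List.count_cons_self]
    omega
  | Step.N :: rest, k + 1 => by
    have := ebn_le_count rest k
    simpa [ebn] using this

theorem abs_areaC_le {π : List Step} (h : IsLatticePath n n π) (p : Fin n) :
    |areaC n π (n - p.val)| ≤ n := by
  have h1 := ebn_le_count π (n + 1 - (n - p.val))
  rw [h.1] at h1
  have := p.isLt
  rw [areaC, abs_le]
  push_cast [this.le]
  omega

theorem areaCList_reverse (π : List Step) :
    (areaCList n π).reverse = (List.finRange n).map fun p => areaC n π (n - p.val) := by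
  apply List.ext_getElem
  · simp [areaCList]
  · intro i h1 h2
    simp only [List.length_map, List.length_finRange] at h2
    simp only [areaCList, List.getElem_reverse, List.length_map, List.length_range,
      List.getElem_map, List.getElem_range, List.getElem_finRange, Fin.val_cast]
    congr 1
    omega

theorem zetaC_eq_map_keyedZeta (π : List Step) :
    zetaC n π = (keyedZeta fun p : Fin n => areaC n π (n - p.val)).map Prod.fst := by
  have hL : areaCList n π =
      (List.finRange n).reverse.map fun p : Fin n => areaC n π (n - p.val) := by
    rw [List.map_reverse, ← areaCList_reverse, List.reverse_reverse]
  rw [zetaC, bind_pure_natCast, keyedZeta, List.map_flatten, List.map_map, List.map_map]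
  congr 1
  refine List.map_congr_left fun j _ => ?_
  rw [Function.comp_apply, Function.comp_apply, List.map_append, sMinusR, sMinusL, areaCList_reverse, sPlusL, hL,
    minusBlock, plusBlock, List.filterMap_map, List.filterMap_map, List.map_filterMap,
    List.map_filterMap]
  congr 1 <;>
  · refine List.filterMap_congr fun p _ => ?_
    simp only [Function.comp_apply]
    split_ifs <;> rfl

theorem isSignedPerm_dC {π : List Step} {u : Fin n → ℤ} (hu : IsSignedPerm n u)
    (ha : ∀ p : Fin n, |areaC n π (n - p.val)| ≤ n) : IsSignedPerm n (dC n π u) := by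
  obtain ⟨σ, -, hσ⟩ := exists_reading_perm u ha
  have habs : ∀ t, |dC n π u t| = |u (σ t)| := by
    intro t
    rw [hσ, itemLabel]
    split_ifs <;> simp
  refine ⟨fun t => by rw [habs]; exact hu.1 _, fun s t h => ?_⟩
  simp only [habs] at h
  exact σ.injective (hu.2 h)

end Reading

/-! ### The ideal of the zeta image -/

section Ideal

variable {n : ℕ}

theorem cellVec_sub_mem_idealC_iff {β : List Step} (hlen : β.length = 2 * n)
    (hβ : ∀ k, (β.take k).count Step.E ≤ (β.take k).count Step.N) {i j : ℕ} (hi : 1 ≤ i)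
    (hij : i < j) (hs : i + j ≤ 2 * n + 1) :
    cellVec n i - cellVec n j ∈ idealC n β ↔
      ¬ ∃ k, i ≤ (β.take k).count Step.E ∧ (β.take k).count Step.N < j := by
  have hmem := cellVec_sub_mem_posRootsC (n := n) hi hij (by omega)
  have hvalley : ∀ i' j', IsValley β i' j' →
      (rootLE n (rootOfValleyC n i' j') (cellVec n i - cellVec n j) ↔ i ≤ i' ∧ j' ≤ j) := by
    intro i' j' h
    obtain ⟨k, h1, h2, h3⟩ := h.exists_take
    have h4 := hβ k
    have h5 := count_E_add_count_N (β.take k)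
    have h6 : (β.take k).length ≤ β.length := List.length_take_le' k β
    rw [rootOfValleyC_eq j' (by omega),
      rootLE_cellVec_iff h3 (by omega) (by omega) hi hij hs]
  rw [← exists_isValley_iff β hi, idealC, Set.mem_ofPred_eq]
  refine ⟨?_, fun h => ⟨hmem, ?_⟩⟩
  · rintro ⟨-, h⟩ ⟨i', j', hv, hle⟩
    exact h ⟨_, ⟨i', j', hv, rfl⟩, (hvalley i' j' hv).2 hle⟩
  · rintro ⟨_, ⟨i', j', hv, rfl⟩, hle⟩
    exact h ⟨i', j', hv, (hvalley i' j' hv).1 hle⟩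

theorem count_take_E_le_N {a : Fin n → ℤ} (ha : ∀ p, |a p| ≤ n) (k : ℕ) :
    (((keyedZeta a).map Prod.fst).take k).count Step.E ≤
      (((keyedZeta a).map Prod.fst).take k).count Step.N := by
  by_cases hk : ((keyedZeta a).map Prod.fst).take k = []
  · simp [hk]
  · obtain ⟨c, hc⟩ := exists_key_of_take (pairwise_keyedZeta a) k hk
    rw [hc, hc, countP_keyedZeta_E ha, countP_keyedZeta_N ha]
    refine le_add_right (Finset.card_le_card fun p => ?_)
    simp only [Finset.mem_filter, Finset.mem_univ, true_and]
    exact fun h => (nKey_lt_eKey a p).le.trans h.2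

theorem length_keyedZeta {a : Fin n → ℤ} (ha : ∀ p, |a p| ≤ n) :
    (keyedZeta a).length = 2 * n := by
  have hmax : ∀ p, nKey a p ≤ toLex (2 * (n : ℤ) + 3, 0) ∧
      eKey a p ≤ toLex (2 * (n : ℤ) + 3, 0) ∧ zKey p ≤ toLex (2 * (n : ℤ) + 3, 0) := by
    intro p
    have := abs_le.1 (ha p)
    simp only [nKey, eKey, zKey, Prod.Lex.toLex_le_toLex]
    split_ifs <;> simp only <;> omega
  have hle : ∀ x ∈ keyedZeta a, x.2 ≤ toLex (2 * (n : ℤ) + 3, 0) := by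
    rintro ⟨_ | _, c⟩ hx
    · rcases (mem_keyedZeta_N ha).1 hx with ⟨p, rfl⟩ | ⟨p, -, rfl⟩
      · exact (hmax p).1
      · exact (hmax p).2.2
    · obtain ⟨p, -, rfl⟩ := (mem_keyedZeta_E ha).1 hx
      exact (hmax p).2.1
  have hcount : ∀ s, ((keyedZeta a).map Prod.fst).count s = (keyedZeta a).countP
      fun x => decide (x.1 = s ∧ x.2 ≤ toLex (2 * (n : ℤ) + 3, 0)) := by
    intro s
    rw [List.count, List.countP_map]
    refine List.countP_congr fun x hx => ?_
    simp [hle x hx]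
  have h := count_E_add_count_N ((keyedZeta a).map Prod.fst)
  rw [hcount, hcount, countP_keyedZeta_E ha, countP_keyedZeta_N ha, List.length_map] at h
  simp only [hmax, and_true, Finset.filter_true, Finset.card_univ, Fintype.card_fin] at h
  have hsplit := Finset.card_filter_add_card_filter_not (s := (Finset.univ : Finset (Fin n)))
    fun p => a p = 0
  rw [Finset.card_univ, Fintype.card_fin] at hsplit
  simp only [ne_eq] at h
  omega

theorem exists_take_iff_exists_key {a : Fin n → ℤ} (ha : ∀ p, |a p| ≤ n) {i j : ℕ} (hi : 1 ≤ i) :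
    (∃ k, i ≤ (((keyedZeta a).map Prod.fst).take k).count Step.E ∧
      (((keyedZeta a).map Prod.fst).take k).count Step.N < j) ↔
    ∃ c, i ≤ (Finset.univ.filter fun p => a p ≠ 0 ∧ eKey a p ≤ c).card ∧
      (Finset.univ.filter fun p => nKey a p ≤ c).card +
      (Finset.univ.filter fun p => a p = 0 ∧ zKey p ≤ c).card < j := by
  simp only [← countP_keyedZeta_E ha, ← countP_keyedZeta_N ha]
  constructor
  · rintro ⟨k, h1, h2⟩
    have hk : ((keyedZeta a).map Prod.fst).take k ≠ [] := by
      intro hk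
      rw [hk, List.count_nil] at h1
      omega
    obtain ⟨c, hc⟩ := exists_key_of_take (pairwise_keyedZeta a) k hk
    exact ⟨c, by rwa [← hc], by rwa [← hc]⟩
  · rintro ⟨c, h1, h2⟩
    obtain ⟨k, hk⟩ := exists_take_of_key (pairwise_keyedZeta a) c
    exact ⟨k, by rwa [hk], by rwa [hk]⟩

variable {a : Fin n → ℤ} {σ : Equiv.Perm (Fin n)}

theorem card_nKey_le (hσ : StrictAnti fun t => nKey a (σ t)) (t : Fin n) :
    (Finset.univ.filter fun p => nKey a p ≤ nKey a (σ t)).card = n - t.val := by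
  rw [← Fin.card_Ici, ← Finset.card_map (s := Finset.Ici t) σ.toEmbedding]
  congr 1
  ext p
  obtain ⟨s, rfl⟩ := σ.surjective p
  simp [hσ.le_iff_ge]

theorem card_nKey_lt (hσ : StrictAnti fun t => nKey a (σ t)) (t : Fin n) :
    (Finset.univ.filter fun p => nKey a p < nKey a (σ t)).card = n - 1 - t.val := by
  rw [← Fin.card_Ioi, ← Finset.card_map (s := Finset.Ioi t) σ.toEmbedding]
  congr 1
  ext p
  obtain ⟨s, rfl⟩ := σ.surjective p
  simp [hσ.lt_iff_gt]

theorem card_nKey_ge (hσ : StrictAnti fun t => nKey a (σ t)) (t : Fin n) :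
    (Finset.univ.filter fun p => nKey a (σ t) ≤ nKey a p).card = t.val + 1 := by
  rw [← Fin.card_Iic, ← Finset.card_map (s := Finset.Iic t) σ.toEmbedding]
  congr 1
  ext p
  obtain ⟨s, rfl⟩ := σ.surjective p
  simp [hσ.le_iff_ge]

theorem card_nKey_gt (hσ : StrictAnti fun t => nKey a (σ t)) (t : Fin n) :
    (Finset.univ.filter fun p => nKey a (σ t) < nKey a p).card = t.val := by
  rw [← Fin.card_Iio, ← Finset.card_map (s := Finset.Iio t) σ.toEmbedding]
  congr 1
  ext p
  obtain ⟨s, rfl⟩ := σ.surjective p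
  simp [hσ.lt_iff_gt]

theorem le_card_eKey_iff (hσ : StrictAnti fun t => nKey a (σ t)) (t : Fin n) (c : ℤ ×ₗ ℤ) :
    n - t.val ≤ (Finset.univ.filter fun p => a p ≠ 0 ∧ eKey a p ≤ c).card ↔
      a (σ t) ≠ 0 ∧ eKey a (σ t) ≤ c := by
  constructor
  · intro h
    by_contra hneg
    have hsub : (Finset.univ.filter fun p => a p ≠ 0 ∧ eKey a p ≤ c).card ≤
        (Finset.univ.filter fun p => nKey a p < nKey a (σ t)).card := by
      refine Finset.card_le_card fun p => ?_
      simp only [Finset.mem_filter, Finset.mem_univ, true_and]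
      rintro ⟨h1, h2⟩
      by_contra hlt
      have hle := not_lt.1 hlt
      exact hneg ⟨fun h0 => h1 (eq_zero_of_nKey_le h0 hle),
        ((eKey_le_eKey_iff a _ _).2 hle).trans h2⟩
    rw [card_nKey_lt hσ] at hsub
    omega
  · rintro ⟨h1, h2⟩
    rw [← card_nKey_le hσ]
    refine Finset.card_le_card fun p => ?_
    simp only [Finset.mem_filter, Finset.mem_univ, true_and]
    exact fun hp => ⟨fun h0 => h1 (eq_zero_of_nKey_le h0 hp),
      ((eKey_le_eKey_iff a _ _).2 hp).trans h2⟩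

theorem card_nKey_add_lt_iff (hσ : StrictAnti fun t => nKey a (σ t)) (s : Fin n) (c : ℤ ×ₗ ℤ) :
    (Finset.univ.filter fun p => nKey a p ≤ c).card +
      (Finset.univ.filter fun p => a p = 0 ∧ zKey p ≤ c).card < n - s.val ↔
      c < nKey a (σ s) := by
  constructor
  · intro h
    by_contra hc
    have hc := not_lt.1 hc
    have hsub : (Finset.univ.filter fun p => nKey a p ≤ nKey a (σ s)).card ≤
        (Finset.univ.filter fun p => nKey a p ≤ c).card := by
      refine Finset.card_le_card fun p => ?_
      simp only [Finset.mem_filter, Finset.mem_univ, true_and]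
      exact fun hp => hp.trans hc
    rw [card_nKey_le hσ] at hsub
    omega
  · intro h
    have hsub : (Finset.univ.filter fun p => nKey a p ≤ c).card ≤
        (Finset.univ.filter fun p => nKey a p < nKey a (σ s)).card := by
      refine Finset.card_le_card fun p => ?_
      simp only [Finset.mem_filter, Finset.mem_univ, true_and]
      exact fun hp => hp.trans_lt h
    have hempty : (Finset.univ.filter fun p => a p = 0 ∧ zKey p ≤ c).card = 0 := by
      rw [Finset.card_eq_zero, Finset.filter_eq_empty_iff]
      rintro p - ⟨-, hp⟩
      exact lt_asymm (nKey_lt_zKey a (σ s) p) (hp.trans_lt h)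
    rw [card_nKey_lt hσ] at hsub
    have := s.isLt
    omega

theorem card_nKey_add_lt_iff' (hσ : StrictAnti fun t => nKey a (σ t)) (s : Fin n)
    (c : ℤ ×ₗ ℤ) :
    (Finset.univ.filter fun p => nKey a p ≤ c).card +
      (Finset.univ.filter fun p => a p = 0 ∧ zKey p ≤ c).card < n + 1 + s.val ↔
      (a (σ s) = 0 → c < zKey (σ s)) := by
  constructor
  · intro h h0
    by_contra hc
    have hc := not_lt.1 hc
    have hall : (Finset.univ.filter fun p => nKey a p ≤ c).card = n := by
      rw [Finset.filter_true_of_mem fun p _ => ((nKey_lt_zKey a p (σ s)).trans_le hc).le,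
        Finset.card_univ, Fintype.card_fin]
    have hsub : (Finset.univ.filter fun p => nKey a (σ s) ≤ nKey a p).card ≤
        (Finset.univ.filter fun p => a p = 0 ∧ zKey p ≤ c).card := by
      refine Finset.card_le_card fun p => ?_
      simp only [Finset.mem_filter, Finset.mem_univ, true_and]
      intro hp
      have hp0 := eq_zero_of_nKey_le h0 hp
      exact ⟨hp0, ((zKey_le_zKey_iff hp0 h0).2 hp).trans hc⟩
    rw [card_nKey_ge hσ] at hsub
    omega
  · intro h
    have hle : (Finset.univ.filter fun p => nKey a p ≤ c).card ≤ n :=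
      (Finset.card_le_univ _).trans_eq (Fintype.card_fin n)
    have hsub : (Finset.univ.filter fun p => a p = 0 ∧ zKey p ≤ c).card ≤
        (Finset.univ.filter fun p => nKey a (σ s) < nKey a p).card := by
      refine Finset.card_le_card fun p => ?_
      simp only [Finset.mem_filter, Finset.mem_univ, true_and]
      rintro ⟨h1, h2⟩
      by_contra hlt
      have hp := not_lt.1 hlt
      have h0 := eq_zero_of_nKey_le h1 hp
      exact (((zKey_le_zKey_iff h0 h1).2 hp).trans h2).not_gt (h h0)
    rw [card_nKey_gt hσ] at hsub
    omega

theorem nKey_lt_eKey_of_zero {p : Fin n} (hp : a p = 0) (q : Fin n) : nKey a q < eKey a p := by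
  simp only [nKey, eKey, hp, Prod.Lex.toLex_lt_toLex]
  split_ifs <;> simp only <;> omega

theorem zKey_lt_eKey_of_zero {p : Fin n} (hp : a p = 0) (q : Fin n) : zKey q < eKey a p := by
  simp only [zKey, eKey, hp, Prod.Lex.toLex_lt_toLex]
  simp

theorem eI_eq_cellVec (t : Fin n) : eI n (t.val + 1) = cellVec n (n - t.val) := by
  rw [cellVec, if_pos (by omega)]
  congr 1
  omega

theorem eI_eq_neg_cellVec (t : Fin n) : eI n (t.val + 1) = -cellVec n (n + 1 + t.val) := by
  rw [cellVec, if_neg (by omega), neg_neg]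
  congr 1
  omega

theorem sub_mem_idealC_iff (ha : ∀ p, |a p| ≤ n) (hσ : StrictAnti fun t => nKey a (σ t))
    {s t : Fin n} (hst : s < t) :
    eI n (t.val + 1) - eI n (s.val + 1) ∈ idealC n ((keyedZeta a).map Prod.fst) ↔
      ¬ eKey a (σ t) < nKey a (σ s) := by
  have ht := t.isLt
  rw [Fin.lt_def] at hst
  rw [eI_eq_cellVec, eI_eq_cellVec, cellVec_sub_mem_idealC_iff (by simp [length_keyedZeta ha])
    (count_take_E_le_N ha) (by omega) (by omega) (by omega),
    exists_take_iff_exists_key ha (by omega), not_iff_not]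
  simp only [le_card_eKey_iff hσ, card_nKey_add_lt_iff hσ]
  exact ⟨fun ⟨c, h1, h2⟩ => h1.2.trans_lt h2, fun h =>
    ⟨_, ⟨fun h0 => lt_asymm h (nKey_lt_eKey_of_zero h0 _), le_rfl⟩, h⟩⟩

theorem add_mem_idealC_iff (ha : ∀ p, |a p| ≤ n) (hσ : StrictAnti fun t => nKey a (σ t))
    {s t : Fin n} (hst : s ≤ t) :
    eI n (t.val + 1) + eI n (s.val + 1) ∈ idealC n ((keyedZeta a).map Prod.fst) ↔
      a (σ s) = 0 ∧ ¬ eKey a (σ t) < zKey (σ s) := by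
  have ht := t.isLt
  have hkey : nKey a (σ t) ≤ nKey a (σ s) := hσ.antitone hst
  rw [Fin.le_def] at hst
  rw [eI_eq_cellVec, eI_eq_neg_cellVec, ← sub_eq_add_neg,
    cellVec_sub_mem_idealC_iff (by simp [length_keyedZeta ha])
    (count_take_E_le_N ha) (by omega) (by omega) (by omega),
    exists_take_iff_exists_key ha (by omega)]
  simp only [le_card_eKey_iff hσ, card_nKey_add_lt_iff' hσ]
  constructor
  · intro h
    have h0 : a (σ s) = 0 := by
      by_contra h0
      exact h ⟨_, ⟨fun h1 => h0 (eq_zero_of_nKey_le h1 hkey), le_rfl⟩, fun h1 => absurd h1 h0⟩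
    exact ⟨h0, fun hlt => h ⟨_, ⟨fun h1 => lt_asymm hlt (zKey_lt_eKey_of_zero h1 _), le_rfl⟩,
      fun _ => hlt⟩⟩
  · rintro ⟨h0, hlt⟩ ⟨c, ⟨-, h1⟩, h2⟩
    exact hlt (h1.trans_lt (h2 h0))

end Ideal

theorem areaPrimeC_eq_sum {n : ℕ} {a u d : Fin n → ℤ} {σ : Equiv.Perm (Fin n)}
    (ha : ∀ p, |a p| ≤ n) (hσ : StrictAnti fun t => nKey a (σ t)) (hd : IsSignedPerm n d)
    (hdσ : ∀ t, d t = itemLabel a u (σ t)) :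
    areaPrimeC n ((keyedZeta a).map Prod.fst) d =
      ∑ p : Fin n × Fin n, areaTerm a u p.1 p.2 := by
  classical
  set S := (Finset.univ.filter fun p : Fin n × Fin n => SubPair a u (σ p.1) (σ p.2)).disjSum
    (Finset.univ.filter fun p : Fin n × Fin n => AddPair a u (σ p.1) (σ p.2)) with hS
  have hsub : ∀ s t, SubPair a u (σ s) (σ t) ↔ s < t ∧
      ¬ eKey a (σ t) < nKey a (σ s) ∧ d s < d t := fun s t => by
    rw [SubPair, hσ.lt_iff_gt, hdσ, hdσ]
  have hadd : ∀ s t, AddPair a u (σ s) (σ t) ↔ s ≤ t ∧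
      (a (σ s) = 0 ∧ ¬ eKey a (σ t) < zKey (σ s)) ∧ 0 < d s + d t := fun s t => by
    rw [AddPair, hσ.le_iff_ge, hdσ, hdσ]
  have himage : {x : Fin n → ℤ | x ∈ idealC n ((keyedZeta a).map Prod.fst) ∧
      actSP n d x ∈ PosRootsC n} = pairRoot n '' (S : Set _) := by
    ext x
    simp only [Set.mem_ofPred_eq, Set.mem_image, Finset.mem_coe]
    constructor
    · rintro ⟨hx, hact⟩
      rcases mem_posRootsC_iff.1 hx.1 with ⟨s, t, hst, rfl⟩ | ⟨s, t, hst, rfl⟩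
      · refine ⟨Sum.inl (s, t), ?_, rfl⟩
        rw [hS, Finset.inl_mem_disjSum, Finset.mem_filter]
        exact ⟨Finset.mem_univ _, (hsub s t).2 ⟨hst, (sub_mem_idealC_iff ha hσ hst).1 hx,
          (actSP_sub_mem_posRootsC_iff hd s t).1 hact⟩⟩
      · refine ⟨Sum.inr (s, t), ?_, rfl⟩
        rw [hS, Finset.inr_mem_disjSum, Finset.mem_filter]
        exact ⟨Finset.mem_univ _, (hadd s t).2 ⟨hst, (add_mem_idealC_iff ha hσ hst).1 hx,
          (actSP_add_mem_posRootsC_iff hd s t).1 hact⟩⟩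
    · rintro ⟨⟨s, t⟩ | ⟨s, t⟩, hp, rfl⟩
      · rw [hS, Finset.inl_mem_disjSum, Finset.mem_filter] at hp
        obtain ⟨hst, h1, h2⟩ := (hsub s t).1 hp.2
        exact ⟨(sub_mem_idealC_iff ha hσ hst).2 h1, (actSP_sub_mem_posRootsC_iff hd s t).2 h2⟩
      · rw [hS, Finset.inr_mem_disjSum, Finset.mem_filter] at hp
        obtain ⟨hst, h1, h2⟩ := (hadd s t).1 hp.2
        exact ⟨(add_mem_idealC_iff ha hσ hst).2 h1, (actSP_add_mem_posRootsC_iff hd s t).2 h2⟩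
  have hinj : Set.InjOn (pairRoot n) (S : Set _) := by
    refine (injOn_pairRoot n).mono ?_
    rintro (⟨s, t⟩ | ⟨s, t⟩) hp <;> rw [Finset.mem_coe, hS] at hp
    · rw [Finset.inl_mem_disjSum, Finset.mem_filter] at hp
      exact ((hsub s t).1 hp.2).1
    · rw [Finset.inr_mem_disjSum, Finset.mem_filter] at hp
      exact ((hadd s t).1 hp.2).1
  rw [areaPrimeC, himage, hinj.ncard_image, Set.ncard_coe_finset, hS,
    Finset.card_disjSum, Finset.card_filter, Finset.card_filter, ← Finset.sum_add_distrib]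
  exact Equiv.sum_comp (Equiv.prodCongr σ σ) fun p => areaTerm a u p.1 p.2

/-- For every `(π,u) ∈ Vert(Cₙ)`,
`dinv'_C(π,u) = area'(ζ_C(π), d_C(π,u))`. -/
theorem dinvPrimeC_eq_areaPrime (n : ℕ) (hn : 1 ≤ n) (π : List Step) (u : Fin n → ℤ)
    (hmem : (π, u) ∈ VertC n) :
    dinvPrimeC n π u = areaPrimeC n (zetaC n π) (dC n π u) := by
  have ha := abs_areaC_le hmem.1
  obtain ⟨σ, hσ, hdσ⟩ := exists_reading_perm u ha
  rw [dinvPrimeC_eq_sum, zetaC_eq_map_keyedZeta,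
    areaPrimeC_eq_sum ha hσ (isSignedPerm_dC hmem.2.1 ha) hdσ, sum_areaTerm_eq_sum_dinvTerm]
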